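/- Deterministic trimming of redundant checks via LP excess. Let G = {G_n}_n be an infinite family of Tanner graphs, where G_n has n variable nodes and maximum check degree at most a constant d, and assume G is asymptotically strong. Let M > 0 and ε > 0 be constants. Then there exist a constant k ≥ d (depending only on ε, M and the family G) and an integer N such that for all n ≥ N and every vector l ∈ ℝ^n with ‖l‖_∞ ≤ M: if the P(Ḡ_n)-LP decoder succeeds on l − ε𝟙 (where 𝟙 is the all-ones vector and Ḡ_n has as checks all nonzero dual codewords of C(G_n)), then the P(Ḡ_n^k)-LP decoder succeeds on l (where Ḡ_n^k has as checks all nonzero dual codewords of C(G_n) of Hamming weight at most k). -/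

import Mathlib

open Finset Filter

/-- The binary linear code of a Tanner graph with check set `H ⊆ F₂^n`. -/
def tannerCode {n : ℕ} (H : Set (Fin n → ZMod 2)) : Set (Fin n → ZMod 2) :=
  {x | ∀ h ∈ H, ∑ i, h i * x i = 0}

/-- Embedding of a binary vector into `ℝ^n`. -/
noncomputable def toRealVec {n : ℕ} (x : Fin n → ZMod 2) : Fin n → ℝ :=
  fun i => ((x i).val : ℝ)

/-- The Feldman LP polytope of a Tanner graph with check set `H`: the intersection, over
checks `h`, of the convex hulls of the binary vectors satisfying check `h`. -/
def feldmanPolytope {n : ℕ} (H : Set (Fin n → ZMod 2)) : Set (Fin n → ℝ) :=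
  ⋂ h ∈ H, convexHull ℝ
    {ξ | ∃ x : Fin n → ZMod 2, ξ = toRealVec x ∧ ∑ i, h i * x i = 0}

/-- The `P`-LP decoder succeeds on `l` if `⟨x, l⟩ > 0` for every nonzero `x ∈ P`. -/
def LPsucceeds {n : ℕ} (P : Set (Fin n → ℝ)) (l : Fin n → ℝ) : Prop :=
  ∀ x ∈ P, x ≠ 0 → 0 < ∑ i, x i * l i

/-- The checks of `Ḡ`: all nonzero dual codewords of the code of `H`. -/
def allDualChecks {n : ℕ} (H : Set (Fin n → ZMod 2)) : Set (Fin n → ZMod 2) :=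
  {h | h ≠ 0 ∧ ∀ x ∈ tannerCode H, ∑ i, h i * x i = 0}

/-- The checks of `Ḡ^k`: all nonzero dual codewords of Hamming weight at most `k`. -/
def dualChecksLe {n : ℕ} (H : Set (Fin n → ZMod 2)) (k : ℕ) : Set (Fin n → ZMod 2) :=
  {h | h ∈ allDualChecks H ∧ hammingNorm h ≤ k}

/-- A family of Tanner graphs is asymptotically strong if for every `ε ∈ (0,1]` there is a
`δ > 0` such that for all sufficiently large `n` and every `U ⊆ {1,…,n}` with `|U| ≤ δn`,
the LP decoder of `G n` succeeds on the vector equal to `-1` on `U` and `ε` elsewhere. -/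
def AsympStrong (G : ∀ n : ℕ, Set (Fin n → ZMod 2)) : Prop :=
  ∀ ε : ℝ, 0 < ε → ε ≤ 1 → ∃ δ : ℝ, 0 < δ ∧ ∃ N : ℕ, ∀ n ≥ N,
    ∀ U : Finset (Fin n), (U.card : ℝ) ≤ δ * n →
      LPsucceeds (feldmanPolytope (G n)) (fun i => if i ∈ U then -1 else ε)


/-- The homogeneous inequalities cutting out, together with nonnegativity, the fundamental cone
of a single check. -/
def CheckIneq {n : ℕ} (h : Fin n → ZMod 2) (x : Fin n → ℝ) : Prop :=
  ∀ i, h i ≠ 0 → x i ≤ ∑ j ∈ univ.filter (fun j => h j ≠ 0 ∧ j ≠ i), x j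

lemma toRealVec_nonneg {n : ℕ} (x : Fin n → ZMod 2) (i : Fin n) : 0 ≤ toRealVec x i :=
  Nat.cast_nonneg _

lemma feldmanPolytope_anti {n : ℕ} {H K : Set (Fin n → ZMod 2)} (hHK : H ⊆ K) :
    feldmanPolytope K ⊆ feldmanPolytope H :=
  Set.biInter_subset_biInter_left hHK

lemma nonneg_of_mem_feldmanPolytope {n : ℕ} {H : Set (Fin n → ZMod 2)} (hH : H.Nonempty)
    {x : Fin n → ℝ} (hx : x ∈ feldmanPolytope H) (i : Fin n) : 0 ≤ x i := by
  obtain ⟨h, hh⟩ := hH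
  have hconv : Convex ℝ {z : Fin n → ℝ | 0 ≤ z i} :=
    convex_halfSpace_ge (LinearMap.isLinear (LinearMap.proj (R := ℝ) i)) 0
  refine convexHull_min ?_ hconv (Set.mem_iInter₂.1 hx h hh)
  rintro _ ⟨z, rfl, -⟩
  exact toRealVec_nonneg z i

lemma checkIneq_toRealVec {n : ℕ} {h x : Fin n → ZMod 2} (hx : ∑ i, h i * x i = 0) :
    CheckIneq h (toRealVec x) := by
  intro i hi
  by_cases hxi : x i = 0
  · have : toRealVec x i = 0 := by simp [toRealVec, hxi]
    rw [this]
    exact sum_nonneg fun j _ => toRealVec_nonneg x j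
  · obtain ⟨j, hji, hj⟩ : ∃ j, j ≠ i ∧ h j * x j ≠ 0 := by
      by_contra! hcon
      rw [Finset.sum_eq_single i (fun j _ hj => hcon j hj) (by simp)] at hx
      exact mul_ne_zero hi hxi hx
    have hone : ∀ a : ZMod 2, a ≠ 0 → a = 1 := by decide
    have hval : ∀ m, x m ≠ 0 → toRealVec x m = 1 := by
      intro m hm
      simp [toRealVec, hone _ hm, ZMod.val_one]
    rw [hval i hxi, ← hval j (right_ne_zero_of_mul hj)]
    exact single_le_sum (f := toRealVec x) (fun m _ => toRealVec_nonneg x m)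
      (by simp [left_ne_zero_of_mul hj, hji])

lemma checkIneq_of_mem_feldmanPolytope {n : ℕ} {H : Set (Fin n → ZMod 2)}
    {x : Fin n → ℝ} (hx : x ∈ feldmanPolytope H) {h : Fin n → ZMod 2} (hh : h ∈ H) :
    CheckIneq h x := by
  intro i hi
  have hconv : Convex ℝ {z : Fin n → ℝ |
      z i ≤ ∑ j ∈ univ.filter (fun j => h j ≠ 0 ∧ j ≠ i), z j} := by
    intro a ha b hb s t hs ht _
    simp only [Set.mem_ofPred_eq, Pi.add_apply, Pi.smul_apply, smul_eq_mul, sum_add_distrib,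
      ← mul_sum] at ha hb ⊢
    exact add_le_add (mul_le_mul_of_nonneg_left ha hs) (mul_le_mul_of_nonneg_left hb ht)
  refine convexHull_min ?_ hconv (Set.mem_iInter₂.1 hx h hh)
  rintro _ ⟨z, rfl, hz⟩
  exact checkIneq_toRealVec hz i hi

/-- A linear functional that is nonpositive on the generators `e_a + e_b` and `e_j` of the
fundamental cone of a check is nonpositive on the whole cone. -/
lemma sum_mul_nonpos_of_checkIneq {n : ℕ} {h : Fin n → ZMod 2} {y c : Fin n → ℝ}
    (hy : ∀ i, 0 ≤ y i) (hyh : CheckIneq h y)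
    (hpair : ∀ a b, a ≠ b → h a ≠ 0 → h b ≠ 0 → c a + c b ≤ 0)
    (hsingle : ∀ j, h j = 0 → c j ≤ 0) : ∑ i, y i * c i ≤ 0 := by
  by_cases hc : ∀ i, c i ≤ 0
  · exact sum_nonpos fun i _ => mul_nonpos_of_nonneg_of_nonpos (hy i) (hc i)
  push Not at hc
  obtain ⟨a, ha⟩ := hc
  have hha : h a ≠ 0 := fun h0 => (hsingle a h0).not_gt ha
  have hrest : ∑ i ∈ univ.erase a, y i * c i
      ≤ ∑ i ∈ univ.erase a, if h i ≠ 0 ∧ i ≠ a then - (c a * y i) else 0 := by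
    refine sum_le_sum fun i hi => ?_
    have hia : i ≠ a := ne_of_mem_erase hi
    split_ifs with hcond
    · have := hpair a i hia.symm hha hcond.1
      nlinarith [hy i]
    · exact mul_nonpos_of_nonneg_of_nonpos (hy i) (hsingle i (by tauto))
  have hfilter : (univ.erase a).filter (fun i => h i ≠ 0 ∧ i ≠ a)
      = univ.filter (fun i => h i ≠ 0 ∧ i ≠ a) := by
    ext i
    simp only [mem_filter, mem_erase, mem_univ]
    tauto
  rw [← sum_filter, hfilter, sum_neg_distrib, ← mul_sum] at hrest
  rw [← add_sum_erase _ _ (mem_univ a)]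
  have := mul_le_mul_of_nonneg_left (hyh a hha) ha.le
  linarith

lemma mem_convexHull_of_checkIneq {n : ℕ} {h : Fin n → ZMod 2} {y : Fin n → ℝ}
    (hy : ∀ i, 0 ≤ y i) (hsum : ∑ i, y i ≤ 1) (hyh : CheckIneq h y) :
    y ∈ convexHull ℝ {ξ | ∃ x : Fin n → ZMod 2, ξ = toRealVec x ∧ ∑ i, h i * x i = 0} := by
  by_contra hmem
  set Q : Set (Fin n → ℝ) := {ξ | ∃ x : Fin n → ZMod 2, ξ = toRealVec x ∧ ∑ i, h i * x i = 0}
    with hQ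
  have hfin : Q.Finite := by
    refine (Set.finite_range (toRealVec (n := n))).subset ?_
    rintro _ ⟨x, rfl, -⟩
    exact ⟨x, rfl⟩
  obtain ⟨f, u, hfu, huy⟩ := geometric_hahn_banach_closed_point (convex_convexHull ℝ Q)
    (hfin.isClosed_convexHull ℝ) hmem
  have hf : ∀ z : Fin n → ℝ, f z = ∑ i, z i * f (Pi.single i 1) := by
    intro z
    conv_lhs => rw [pi_eq_sum_univ' z]
    simp [map_sum]
  have hvert : ∀ x : Fin n → ZMod 2, ∑ i, h i * x i = 0 → f (toRealVec x) < u := fun x hx =>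
    hfu _ (subset_convexHull ℝ Q ⟨x, rfl, hx⟩)
  have hsum_single : ∀ j, ∑ i, h i * (Pi.single j 1 : Fin n → ZMod 2) i = h j := by
    intro j
    simp [Pi.single_apply]
  have hreal_single : ∀ j, toRealVec (Pi.single j 1 : Fin n → ZMod 2) = Pi.single j 1 := by
    intro j
    ext i
    by_cases hij : i = j
    · subst hij
      simp [toRealVec, ZMod.val_one]
    · simp [toRealVec, hij]
  have hu : 0 < u := by
    have := hvert 0 (by simp)
    have h0 : toRealVec (0 : Fin n → ZMod 2) = 0 := by
      ext i
      simp [toRealVec]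
    simpa [h0] using this
  have hone : ∀ a : ZMod 2, a ≠ 0 → a = 1 := by decide
  have hle : ∑ i, y i * (f (Pi.single i 1) - u) ≤ 0 := by
    refine sum_mul_nonpos_of_checkIneq hy hyh ?_ ?_
    · intro a b hab ha hb
      have hlt := hvert (Pi.single a 1 + Pi.single b 1) (by
        simp only [Pi.add_apply, mul_add, sum_add_distrib, hsum_single, hone _ ha, hone _ hb]
        decide)
      have hadd : toRealVec (Pi.single a 1 + Pi.single b 1 : Fin n → ZMod 2)
          = Pi.single a 1 + Pi.single b 1 := by
        rw [← hreal_single a, ← hreal_single b]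
        ext i
        by_cases hia : i = a
        · subst hia
          simp [toRealVec, hab]
        · simp [toRealVec, hia]
      rw [hadd, map_add] at hlt
      linarith
    · intro j hj
      have hlt := hvert (Pi.single j 1) (by rw [hsum_single, hj])
      rw [hreal_single] at hlt
      linarith
  simp only [mul_sub, sum_sub_distrib, ← sum_mul] at hle
  rw [← hf] at hle
  nlinarith

/-- LP success extends from the polytope to the fundamental cone. -/
lemma LPsucceeds.pos_of_checkIneq {n : ℕ} {H : Set (Fin n → ZMod 2)} {l y : Fin n → ℝ}
    (hl : LPsucceeds (feldmanPolytope H) l) (hy : ∀ i, 0 ≤ y i) (hsum : 0 < ∑ i, y i)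
    (hyH : ∀ h ∈ H, CheckIneq h y) : 0 < ∑ i, y i * l i := by
  set s := ∑ i, y i with hs
  have hpos : 0 < ∑ i, (s⁻¹ • y) i * l i := by
    refine hl _ (Set.mem_iInter₂.2 fun h hh => mem_convexHull_of_checkIneq ?_ ?_ ?_) ?_
    · intro i
      exact mul_nonneg (inv_nonneg.2 hsum.le) (hy i)
    · simp only [Pi.smul_apply, smul_eq_mul, ← mul_sum, ← hs]
      exact (inv_mul_cancel₀ hsum.ne').le
    · intro i hi
      simp only [Pi.smul_apply, smul_eq_mul, ← mul_sum]
      exact mul_le_mul_of_nonneg_left (hyH h hh i hi) (inv_nonneg.2 hsum.le)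
    · refine smul_ne_zero (inv_ne_zero hsum.ne') fun h0 => ?_
      simp [hs, h0] at hsum
  simp only [Pi.smul_apply, smul_eq_mul, mul_assoc, ← mul_sum] at hpos
  exact pos_of_mul_pos_right hpos (inv_nonneg.2 hsum.le)

lemma LPsucceeds.nonempty_checks {n : ℕ} (hn : 0 < n) {H : Set (Fin n → ZMod 2)}
    {l : Fin n → ℝ} (hl : LPsucceeds (feldmanPolytope H) l) : H.Nonempty := by
  by_contra hH
  rw [Set.not_nonempty_iff_eq_empty] at hH
  have hne : (fun _ => 1 : Fin n → ℝ) ≠ 0 := fun h0 => by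
    simpa using congrFun h0 ⟨0, hn⟩
  have h1 := hl (fun _ => 1) (by simp [feldmanPolytope, hH]) hne
  have h2 := hl (-fun _ => 1) (by simp [feldmanPolytope, hH]) (neg_ne_zero.2 hne)
  simp only [Pi.neg_apply, neg_mul, sum_neg_distrib] at h2
  linarith

lemma subset_dualChecksLe {n d k : ℕ} {H : Set (Fin n → ZMod 2)}
    (hH : ∀ h ∈ H, h ≠ 0 ∧ hammingNorm h ≤ d) (hdk : d ≤ k) : H ⊆ dualChecksLe H k :=
  fun h hh => ⟨⟨(hH h hh).1, fun _ hx => hx h hh⟩, (hH h hh).2.trans hdk⟩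

lemma min_sum_le_sum_min {ι : Type*} (s : Finset ι) {x : ι → ℝ} (hx : ∀ i, 0 ≤ x i) {T : ℝ}
    (hT : 0 ≤ T) : min (∑ i ∈ s, x i) T ≤ ∑ i ∈ s, min (x i) T := by
  by_cases hall : ∀ i ∈ s, x i ≤ T
  · rw [sum_congr rfl fun i hi => min_eq_left (hall i hi)]
    exact min_le_left _ _
  · push Not at hall
    obtain ⟨i, hi, hTi⟩ := hall
    calc min (∑ i ∈ s, x i) T ≤ min (x i) T := by rw [min_eq_right hTi.le]; exact min_le_right _ _
      _ ≤ _ := single_le_sum (f := fun i => min (x i) T) (fun j _ => le_min (hx j) hT) hi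

open Classical in
/-- Truncating `x` at height `T` and adding `b` on every coordinate on which the code does not
vanish identically. -/
noncomputable def truncateLift {n : ℕ} (H : Set (Fin n → ZMod 2)) (T b : ℝ)
    (x : Fin n → ℝ) : Fin n → ℝ :=
  fun i => if ∀ z ∈ tannerCode H, z i = 0 then 0 else min (x i) T + b

lemma eq_zero_of_forall_codeword_eq_zero {n k : ℕ} (hk : 1 ≤ k) {H : Set (Fin n → ZMod 2)}
    {x : Fin n → ℝ} (hx0 : ∀ i, 0 ≤ x i) (hx : ∀ h ∈ dualChecksLe H k, CheckIneq h x)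
    {i : Fin n} (hi : ∀ z ∈ tannerCode H, z i = 0) : x i = 0 := by
  have hmem : (Pi.single i 1 : Fin n → ZMod 2) ∈ dualChecksLe H k := by
    refine ⟨⟨by simp, fun z hz => ?_⟩, ?_⟩
    · simp [Pi.single_apply, hi z hz]
    · refine le_trans ?_ hk
      rw [hammingNorm, card_le_one]
      intro a ha b hb
      simp only [mem_filter, mem_univ, true_and, Pi.single_apply, ne_eq, ite_eq_right_iff,
        Classical.not_imp] at ha hb
      rw [ha.1, hb.1]
  have h := hx _ hmem i (by simp)
  have hempty : univ.filter (fun j => (Pi.single i 1 : Fin n → ZMod 2) j ≠ 0 ∧ j ≠ i) = ∅ := by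
    ext j
    simp [Pi.single_apply]
  rw [hempty, sum_empty] at h
  exact le_antisymm h (hx0 i)

/-- If `x` satisfies the dual checks of weight at most `k`, then its truncated lift satisfies all
dual checks, provided that `k` copies of the added constant reach the top of the truncation. -/
lemma checkIneq_truncateLift {n k : ℕ} {H : Set (Fin n → ZMod 2)} {T b : ℝ} (hT : 0 ≤ T)
    (hb : 0 ≤ b) (hk : T + b ≤ k * b) {x : Fin n → ℝ} (hx0 : ∀ i, 0 ≤ x i)
    (hx : ∀ h ∈ dualChecksLe H k, CheckIneq h x) {h : Fin n → ZMod 2}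
    (hh : h ∈ allDualChecks H) : CheckIneq h (truncateLift H T b x) := by
  classical
  have hnonneg : ∀ i, 0 ≤ truncateLift H T b x i := by
    intro i
    unfold truncateLift
    split_ifs
    · exact le_rfl
    · exact add_nonneg (le_min (hx0 i) hT) hb
  intro i hi
  by_cases hZ : ∀ z ∈ tannerCode H, z i = 0
  · have : truncateLift H T b x i = 0 := if_pos hZ
    rw [this]
    exact sum_nonneg fun j _ => hnonneg j
  set g : Fin n → ZMod 2 := fun j => if ∀ z ∈ tannerCode H, z j = 0 then 0 else h j with hg
  have hgi : g i ≠ 0 := by simpa only [hg, if_neg hZ] using hi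
  have hg_ne : ∀ j, g j ≠ 0 → h j ≠ 0 ∧ ¬ ∀ z ∈ tannerCode H, z j = 0 := by
    intro j hj
    simp only [hg] at hj
    split_ifs at hj with hZj
    · exact absurd rfl hj
    · exact ⟨hj, hZj⟩
  have hgdual : ∀ z ∈ tannerCode H, ∑ j, g j * z j = 0 := by
    intro z hz
    rw [← hh.2 z hz]
    refine sum_congr rfl fun j _ => ?_
    simp only [hg]
    split_ifs with hZj
    · simp [hZj z hz]
    · rfl
  have hgmem : g ∈ allDualChecks H := ⟨fun h0 => hgi (congrFun h0 i), hgdual⟩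
  set s := univ.filter (fun j => g j ≠ 0 ∧ j ≠ i) with hs
  have hs_val : ∀ j ∈ s, truncateLift H T b x j = min (x j) T + b := by
    intro j hj
    exact if_neg (hg_ne j (mem_filter.1 hj).2.1).2
  have hs_sum : ∑ j ∈ s, truncateLift H T b x j = ∑ j ∈ s, min (x j) T + s.card * b := by
    rw [sum_congr rfl hs_val, sum_add_distrib, sum_const, nsmul_eq_mul]
  have hs_nonempty : s.Nonempty := by
    by_contra hempty
    rw [not_nonempty_iff_eq_empty] at hempty
    refine hZ fun z hz => ?_
    have hsum := hgdual z hz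
    rw [Finset.sum_eq_single i ?_ (by simp)] at hsum
    · exact (mul_eq_zero.1 hsum).resolve_left hgi
    · intro j _ hji
      by_contra hj
      have : j ∈ s := mem_filter.2 ⟨mem_univ j, left_ne_zero_of_mul hj, hji⟩
      simp [hempty] at this
  have hsub : ∑ j ∈ s, truncateLift H T b x j
      ≤ ∑ j ∈ univ.filter (fun j => h j ≠ 0 ∧ j ≠ i), truncateLift H T b x j := by
    refine sum_le_sum_of_subset_of_nonneg ?_ fun j _ _ => hnonneg j
    intro j hj
    have := (mem_filter.1 hj).2
    exact mem_filter.2 ⟨mem_univ j, (hg_ne j this.1).1, this.2⟩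
  refine le_trans ?_ hsub
  have hval : truncateLift H T b x i = min (x i) T + b := if_neg hZ
  rw [hs_sum, hval]
  by_cases hgk : hammingNorm g ≤ k
  · have h1 : min (x i) T ≤ min (∑ j ∈ s, x j) T :=
      min_le_min_right T (hx g ⟨hgmem, hgk⟩ i hgi)
    have h2 := min_sum_le_sum_min s hx0 hT
    have h3 : (1 : ℝ) ≤ s.card := by exact_mod_cast hs_nonempty.card_pos
    nlinarith
  · have hcard : k ≤ s.card := by
      have hins : univ.filter (fun j => g j ≠ 0) ⊆ insert i s := by
        intro j hj
        by_cases hji : j = i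
        · simp [hji]
        · exact mem_insert_of_mem (mem_filter.2 ⟨mem_univ j, (mem_filter.1 hj).2, hji⟩)
      have h1 : hammingNorm g ≤ (insert i s).card := card_le_card hins
      have h2 := card_insert_le i s
      omega
    have h1 : (k : ℝ) ≤ s.card := by exact_mod_cast hcard
    have h2 : 0 ≤ ∑ j ∈ s, min (x j) T := sum_nonneg fun j _ => le_min (hx0 j) hT
    have h3 := min_le_right (x i) T
    nlinarith

/-- **Deterministic trimming of redundant checks via LP excess.**
Let `G` be an asymptotically strong family of Tanner graphs of bounded check degree `d`,
and let `M > 0`, `ε > 0` be constants.  Then there are a constant `k ≥ d` and an `N` such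
that for all `n ≥ N` and every `l ∈ ℝ^n` with `‖l‖_∞ ≤ M`: if the `P(Ḡ_n)`-LP decoder
succeeds on `l − ε𝟙`, then the `P(Ḡ_n^k)`-LP decoder succeeds on `l`. -/
theorem deterministic_trimming
    (d : ℕ) (G : ∀ n : ℕ, Set (Fin n → ZMod 2))
    (hG : ∀ n, ∀ h ∈ G n, h ≠ 0 ∧ hammingNorm h ≤ d)
    (hstrong : AsympStrong G)
    (M : ℝ) (hM : 0 < M) (ε : ℝ) (hε : 0 < ε) :
    ∃ k ≥ d, ∃ N : ℕ, ∀ n ≥ N, ∀ l : Fin n → ℝ, (∀ i, |l i| ≤ M) →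
      LPsucceeds (feldmanPolytope (allDualChecks (G n))) (fun i => l i - ε) →
      LPsucceeds (feldmanPolytope (dualChecksLe (G n) k)) l := by
  set c : ℝ := min (1 / 2) (ε / (4 * M)) with hc
  have hc0 : 0 < c := lt_min (by norm_num) (by positivity)
  have hc_half : c ≤ 1 / 2 := min_le_left _ _
  have hcM : M * c ≤ ε / 4 := by
    calc M * c ≤ M * (ε / (4 * M)) := mul_le_mul_of_nonneg_left (min_le_right _ _) hM.le
      _ = ε / 4 := by field_simp
  obtain ⟨δ, hδ, N, hN⟩ := hstrong c hc0 (hc_half.trans (by norm_num))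
  obtain ⟨m, hm⟩ := exists_nat_ge ((1 / δ + c) / c)
  refine ⟨d + m + 1, by omega, N + 1, fun n hn l hlM hl => ?_⟩
  set k := d + m + 1 with hk
  have hkc : 1 / δ + c ≤ k * c := by
    rw [div_le_iff₀ hc0] at hm
    refine hm.trans (mul_le_mul_of_nonneg_right ?_ hc0.le)
    exact_mod_cast (by omega : m ≤ k)
  have hn0 : (0 : ℝ) < n := by exact_mod_cast (by omega : 0 < n)
  have hG_nonempty : (G n).Nonempty :=
    (hN n (by omega) ∅ (by simpa using (mul_pos hδ hn0).le)).nonempty_checks (by omega)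
  have hsub : G n ⊆ dualChecksLe (G n) k := subset_dualChecksLe (hG n) (by omega)
  intro x hx hxne
  have hxG := feldmanPolytope_anti hsub hx
  have hx0 := nonneg_of_mem_feldmanPolytope hG_nonempty hxG
  have hxk : ∀ h ∈ dualChecksLe (G n) k, CheckIneq h x := fun h hh =>
    checkIneq_of_mem_feldmanPolytope hx hh
  by_contra! hneg
  set S := ∑ i, x i with hS
  have hS0 : 0 < S := by
    obtain ⟨i, hi⟩ := Function.ne_iff.1 hxne
    exact sum_pos' (fun i _ => hx0 i) ⟨i, mem_univ i, (hx0 i).lt_of_ne' hi⟩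
  set a := S / n with ha
  have ha0 : 0 < a := div_pos hS0 hn0
  have hna : n * a = S := by rw [ha]; field_simp
  set T := a / δ with hT
  have hT0 : 0 < T := div_pos ha0 hδ
  set U := univ.filter (fun i => T < x i) with hU
  have hUcard : (U.card : ℝ) ≤ δ * n := by
    have h1 : U.card * T ≤ S := by
      calc (U.card : ℝ) * T = ∑ _i ∈ U, T := by rw [sum_const, nsmul_eq_mul]
        _ ≤ ∑ i ∈ U, x i := sum_le_sum fun i hi => (mem_filter.1 hi).2.le
        _ ≤ S := sum_le_sum_of_subset_of_nonneg (subset_univ _) fun i _ _ => hx0 i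
    have h2 : δ * n * T = S := by rw [hT, ← hna]; field_simp
    exact le_of_mul_le_mul_right (h1.trans h2.ge) hT0
  have hmass : ∑ i, (if i ∈ U then x i else 0) ≤ c * S := by
    have h1 := hN n (by omega) U hUcard x hxG hxne
    have h2 : ∑ i, x i * (if i ∈ U then -1 else c)
        ≤ ∑ i, (c * x i - if i ∈ U then x i else 0) := by
      refine sum_le_sum fun i _ => ?_
      split_ifs
      · nlinarith [hx0 i]
      · linarith
    rw [sum_sub_distrib, ← mul_sum] at h2
    linarith
  set y := truncateLift (G n) T (c * a) x with hy
  have hyH : ∀ h ∈ allDualChecks (G n), CheckIneq h y := fun h hh => by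
    refine checkIneq_truncateLift hT0.le (by positivity) ?_ hx0 hxk hh
    calc T + c * a = (1 / δ + c) * a := by rw [hT]; ring
      _ ≤ k * c * a := mul_le_mul_of_nonneg_right hkc ha0.le
      _ = k * (c * a) := by ring
  have hca : 0 < c * a := mul_pos hc0 ha0
  have hy_bounds : ∀ i, 0 ≤ y i ∧ x i - (if i ∈ U then x i else 0) ≤ y i ∧
      y i ≤ x i + c * a := by
    intro i
    have hxi := hx0 i
    simp only [hy, truncateLift]
    split_ifs with hZ hiU hiU
    · exact ⟨le_rfl, by linarith, by linarith⟩
    · have := eq_zero_of_forall_codeword_eq_zero (by omega) hx0 hxk hZ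
      exact ⟨le_rfl, by linarith, by linarith⟩
    · have h1 := min_le_left (x i) T
      have h2 := le_min hxi hT0.le
      exact ⟨by linarith, by linarith, by linarith⟩
    · have h1 : x i ≤ T := by simpa [hU] using hiU
      rw [min_eq_left h1]
      exact ⟨by linarith, by linarith, by linarith⟩
  have hysum : (1 - c) * S ≤ ∑ i, y i := by
    have := sum_le_sum fun i (_ : i ∈ univ) => (hy_bounds i).2.1
    rw [sum_sub_distrib] at this
    linarith
  have hysum0 : 0 < ∑ i, y i := lt_of_lt_of_le (mul_pos (by linarith) hS0) hysum
  have hpos := hl.pos_of_checkIneq (fun i => (hy_bounds i).1) hysum0 hyH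
  have hterm : ∑ i, y i * (l i - ε)
      ≤ ∑ i, (x i * l i + M * ((if i ∈ U then x i else 0) + c * a) - ε * y i) := by
    refine sum_le_sum fun i _ => ?_
    have hdiff : |y i - x i| ≤ (if i ∈ U then x i else 0) + c * a := by
      obtain ⟨-, h1, h2⟩ := hy_bounds i
      have h3 : 0 ≤ if i ∈ U then x i else 0 := by
        split_ifs
        · exact hx0 i
        · exact le_rfl
      rw [abs_le]
      constructor <;> linarith
    have h1 : (y i - x i) * l i ≤ M * ((if i ∈ U then x i else 0) + c * a) := by
      calc (y i - x i) * l i ≤ |y i - x i| * |l i| := by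
            rw [← abs_mul]
            exact le_abs_self _
        _ ≤ ((if i ∈ U then x i else 0) + c * a) * M :=
            mul_le_mul hdiff (hlM i) (abs_nonneg _) ((abs_nonneg _).trans hdiff)
        _ = _ := mul_comm _ _
    linarith
  rw [sum_sub_distrib, sum_add_distrib, ← mul_sum, ← mul_sum, sum_add_distrib, sum_const,
    card_univ, Fintype.card_fin, nsmul_eq_mul] at hterm
  have hna' : n * (c * a) = c * S := by rw [← hna]; ring
  rw [hna'] at hterm
  have h1 : M * (∑ i, (if i ∈ U then x i else 0) + c * S) ≤ M * (c * S + c * S) :=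
    mul_le_mul_of_nonneg_left (by linarith) hM.le
  have h2 : M * (c * S + c * S) ≤ ε / 2 * S := by nlinarith
  have h3 : ε / 2 * S ≤ ε * ∑ i, y i := by
    calc ε / 2 * S = ε * (1 / 2 * S) := by ring
      _ ≤ ε * ∑ i, y i := by
        refine mul_le_mul_of_nonneg_left (le_trans ?_ hysum) hε.le
        exact mul_le_mul_of_nonneg_right (by linarith) hS0.le
  linarith
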